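/- (Weak Contextual Equivalence Lemma) Let φ be an LTL formula and B a finite basis of formulas. Assume that for every C ⊆ B there is a formula φ_C such that (i) φ and φ_C are equivalent under context ⟨C,B⟩, and (ii) for all C, C' ⊆ B with C ⊆ C', φ_C ⊨ φ_{C'}. Then φ ≡ ⋁_{C ⊆ B} ( φ_C ∧ ⋀_{ψ ∈ C} ψ ), where the disjunction ranges over all subsets C of B. -/

import Mathlib

namespace LTLNorm

/-- LTL formulas in negation normal form. -/
inductive F (Ap : Type) : Type
  | tt    : F Ap
  | ff    : F Ap
  | pos   : Ap → F Ap
  | nlit  : Ap → F Ap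
  | and   : F Ap → F Ap → F Ap
  | or    : F Ap → F Ap → F Ap
  | next  : F Ap → F Ap
  | untl  : F Ap → F Ap → F Ap
  | wuntl : F Ap → F Ap → F Ap
  | rel   : F Ap → F Ap → F Ap
  | srel  : F Ap → F Ap → F Ap
  deriving DecidableEq

/-- Infinite words over the alphabet `2^Ap`. -/
abbrev Word (Ap : Type) := ℕ → Set Ap

/-- Suffix of a word starting at position `i`. -/
def suff {Ap : Type} (w : Word Ap) (i : ℕ) : Word Ap := fun n => w (n + i)

/-- Satisfaction relation. -/
def Sat {Ap : Type} : Word Ap → F Ap → Prop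
  | _, F.tt => True
  | _, F.ff => False
  | w, F.pos a => a ∈ w 0
  | w, F.nlit a => a ∉ w 0
  | w, F.and φ ψ => Sat w φ ∧ Sat w ψ
  | w, F.or φ ψ => Sat w φ ∨ Sat w ψ
  | w, F.next φ => Sat (suff w 1) φ
  | w, F.untl φ ψ => ∃ k, Sat (suff w k) ψ ∧ ∀ j < k, Sat (suff w j) φ
  | w, F.wuntl φ ψ => (∀ k, Sat (suff w k) φ) ∨ ∃ k, Sat (suff w k) ψ ∧ ∀ j < k, Sat (suff w j) φ
  | w, F.srel φ ψ => ∃ k, Sat (suff w k) φ ∧ ∀ j ≤ k, Sat (suff w j) ψ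
  | w, F.rel φ ψ => (∀ k, Sat (suff w k) ψ) ∨ ∃ k, Sat (suff w k) φ ∧ ∀ j ≤ k, Sat (suff w j) ψ

/-- Equivalence of formulas. -/
def Equiv {Ap : Type} (φ ψ : F Ap) : Prop := ∀ w : Word Ap, Sat w φ ↔ Sat w ψ

/-- Entailment: every word satisfying `φ` satisfies `ψ`. -/
def Entails {Ap : Type} (φ ψ : F Ap) : Prop := ∀ w : Word Ap, Sat w φ → Sat w ψ

/-- F φ := tt U φ -/
def Ff {Ap : Type} (φ : F Ap) : F Ap := F.untl F.tt φ
/-- G φ := φ W ff -/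
def Gf {Ap : Type} (φ : F Ap) : F Ap := F.wuntl φ F.ff
/-- GF φ := G (F φ) -/
def GFf {Ap : Type} (φ : F Ap) : F Ap := Gf (Ff φ)
/-- FG φ := F (G φ) -/
def FGf {Ap : Type} (φ : F Ap) : F Ap := Ff (Gf φ)

/-- Number of nodes of the syntax tree. -/
def size {Ap : Type} : F Ap → ℕ
  | F.tt => 1
  | F.ff => 1
  | F.pos _ => 1
  | F.nlit _ => 1
  | F.and φ ψ => size φ + size ψ + 1
  | F.or φ ψ => size φ + size ψ + 1
  | F.next φ => size φ + 1
  | F.untl φ ψ => size φ + size ψ + 1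
  | F.wuntl φ ψ => size φ + size ψ + 1
  | F.rel φ ψ => size φ + size ψ + 1
  | F.srel φ ψ => size φ + size ψ + 1

/-- The dual of a formula in negation normal form. -/
def dual {Ap : Type} : F Ap → F Ap
  | F.tt => F.ff
  | F.ff => F.tt
  | F.pos a => F.nlit a
  | F.nlit a => F.pos a
  | F.and φ ψ => F.or (dual φ) (dual ψ)
  | F.or φ ψ => F.and (dual φ) (dual ψ)
  | F.next φ => F.next (dual φ)
  | F.untl φ ψ => F.rel (dual φ) (dual ψ)
  | F.rel φ ψ => F.untl (dual φ) (dual ψ)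
  | F.wuntl φ ψ => F.srel (dual φ) (dual ψ)
  | F.srel φ ψ => F.wuntl (dual φ) (dual ψ)

/-- `LangC B C` is the set of words satisfying every formula of `C` and
no formula of `B \ C` (the language of the context `⟨C,B⟩`). -/
def LangC {Ap : Type} (B C : Finset (F Ap)) : Set (Word Ap) :=
  {w | (∀ ψ ∈ C, Sat w ψ) ∧ ∀ ψ ∈ B, ψ ∉ C → ¬ Sat w ψ}

/-- Equivalence under the context `⟨C,B⟩`. -/
def EquivUnder {Ap : Type} (B C : Finset (F Ap)) (φ₁ φ₂ : F Ap) : Prop :=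
  ∀ w ∈ LangC B C, (Sat w φ₁ ↔ Sat w φ₂)

/-- Disjunction of a list of formulas. -/
def bigOr {Ap : Type} (l : List (F Ap)) : F Ap := l.foldr F.or F.ff

/-- Conjunction of a list of formulas. -/
def bigAnd {Ap : Type} (l : List (F Ap)) : F Ap := l.foldr F.and F.tt

theorem sat_bigOr {Ap : Type} (w : Word Ap) (l : List (F Ap)) :
    Sat w (bigOr l) ↔ ∃ ψ ∈ l, Sat w ψ := by
  induction l with
  | nil => simp [bigOr, Sat]
  | cons a l ih =>
    change Sat w a ∨ Sat w (bigOr l) ↔ _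
    simp [ih]

theorem sat_bigAnd {Ap : Type} (w : Word Ap) (l : List (F Ap)) :
    Sat w (bigAnd l) ↔ ∀ ψ ∈ l, Sat w ψ := by
  induction l with
  | nil => simp [bigAnd, Sat]
  | cons a l ih =>
    change Sat w a ∧ Sat w (bigAnd l) ↔ _
    simp [ih]

open Classical in
/-- A word lies in the language of the context given by the basis formulas it satisfies. -/
theorem mem_langC_filter {Ap : Type} (B : Finset (F Ap)) (w : Word Ap) :
    w ∈ LangC B (B.filter (Sat w)) :=
  ⟨fun _ hψ => (Finset.mem_filter.mp hψ).2,
    fun _ hψ hn hs => hn (Finset.mem_filter.mpr ⟨hψ, hs⟩)⟩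

/-- Weak Contextual Equivalence Lemma. -/
theorem weak_contextual_equivalence {Ap : Type} [Fintype Ap] [DecidableEq Ap]
    (φ : F Ap) (B : Finset (F Ap)) (f : Finset (F Ap) → F Ap)
    (h1 : ∀ C ⊆ B, EquivUnder B C φ (f C))
    (h2 : ∀ C C' : Finset (F Ap), C ⊆ B → C' ⊆ B → C ⊆ C' → Entails (f C) (f C')) :
    Equiv φ
      (bigOr (B.powerset.toList.map fun C => F.and (f C) (bigAnd C.toList))) := by
  classical
  intro w
  have hB : B.filter (Sat w) ⊆ B := Finset.filter_subset _ _
  have hφ : Sat w φ ↔ Sat w (f (B.filter (Sat w))) :=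
    h1 _ hB w (by convert mem_langC_filter B w)
  simp only [sat_bigOr, List.mem_map, Finset.mem_toList, Finset.mem_powerset,
    exists_exists_and_eq_and, Sat, sat_bigAnd]
  constructor
  · exact fun h => ⟨_, hB, hφ.mp h, fun _ hψ => (Finset.mem_filter.mp hψ).2⟩
  · rintro ⟨C, hC, hf, hsat⟩
    have hCw : C ⊆ B.filter (Sat w) :=
      fun ψ hψ => Finset.mem_filter.mpr ⟨hC hψ, hsat ψ hψ⟩
    exact hφ.mpr (h2 C _ hC hB hCw w hf)

end LTLNorm
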